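/- For each integer k ≥ 1 there exists a positive integer n_0 = n_0(k) such that for every even integer n ≥ n_0, R(C_n, B_n^{(k)}) = (k+1)(n−1) + 1. -/

import Mathlib

/-- `G` contains a cycle of length `m`. -/
def HasCycleLen {V : Type*} (G : SimpleGraph V) (m : ℕ) : Prop :=
  ∃ (v : V) (c : G.Walk v v), c.IsCycle ∧ c.length = m

/-- `G` contains the book `B_n^{(k)}`: a clique on `k` vertices together with
`n` further vertices each adjacent to all of them. -/
def HasBook {V : Type*} (G : SimpleGraph V) (k n : ℕ) : Prop :=
  ∃ S T : Finset V, S.card = k ∧ T.card = n ∧ Disjoint S T ∧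
    (∀ u ∈ S, ∀ v ∈ S, u ≠ v → G.Adj u v) ∧
    (∀ u ∈ S, ∀ v ∈ T, G.Adj u v)

/-- Every simple graph on `N` vertices contains `C_m` or its complement contains
`B_n^{(k)}`. The Ramsey number `R(C_m, B_n^{(k)})` is the least such `N`. -/
def RamseyProp (m k n N : ℕ) : Prop :=
  ∀ G : SimpleGraph (Fin N), HasCycleLen G m ∨ HasBook Gᶜ k n


section Aux
open scoped Classical

theorem cyc_of_list {V : Type*} {G : SimpleGraph V} (l : List V) (hn : l.Nodup)
    (hc : l.IsChain G.Adj) (h3 : 3 ≤ l.length)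
    (hl : ∀ x ∈ l.getLast?, ∀ y ∈ l.head?, G.Adj x y) : HasCycleLen G l.length := by
  match l, h3 with
  | u :: v :: w :: r, _ =>
    have hne : (v :: w :: r) ≠ [] := by simp
    have hne' : (u :: v :: w :: r) ≠ [] := by simp
    have hlast : (u :: v :: w :: r).getLast hne' = (v :: w :: r).getLast hne := by simp
    have hc2 : (v :: w :: r).IsChain G.Adj := (List.isChain_cons_cons.1 hc).2
    have huv : G.Adj u v := (List.isChain_cons_cons.1 hc).1
    obtain ⟨p, hs, hlen⟩ : ∃ p : G.Walk v ((v :: w :: r).getLast hne),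
        p.support = v :: w :: r ∧ p.length = (v :: w :: r).length - 1 :=
      ⟨SimpleGraph.Walk.ofSupport (v :: w :: r) hne hc2,
        SimpleGraph.Walk.support_ofSupport _ _, SimpleGraph.Walk.length_ofSupport _ _⟩
    have hadj : G.Adj ((v :: w :: r).getLast hne) u := by
      apply hl _ _ u (by simp)
      rw [List.getLast?_eq_some_getLast hne', hlast]; simp
    refine ⟨_, SimpleGraph.Walk.cons hadj (SimpleGraph.Walk.cons huv p), ?_, ?_⟩
    · rw [SimpleGraph.Walk.cons_isCycle_iff]
      constructor
      · rw [SimpleGraph.Walk.isPath_def, SimpleGraph.Walk.support_cons, hs]; exact hn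
      · rw [SimpleGraph.Walk.edges_cons, List.mem_cons]
        rintro (h | h)
        · rw [Sym2.eq_iff] at h
          have hv : (v :: w :: r).getLast hne = v := by
            rcases h with ⟨h1, h2⟩ | ⟨h1, h2⟩
            · exact absurd h2 huv.ne
            · exact h1
          have : (w :: r).getLast (by simp) ∈ w :: r := List.getLast_mem _
          rw [List.getLast_cons (by simp)] at hv
          rw [hv] at this
          simp at hn this
          tauto
        · have := SimpleGraph.Walk.snd_mem_support_of_mem_edges _ h
          rw [hs] at this
          exact (List.nodup_cons.1 hn).1 this
    · rw [SimpleGraph.Walk.length_cons, SimpleGraph.Walk.length_cons, hlen]; simp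

/-- path on the first `t` values -/
def IsPth {V : Type*} (G : SimpleGraph V) (f : ℕ → V) (t : ℕ) : Prop :=
  (∀ i j, i < t → j < t → f i = f j → i = j) ∧ ∀ j, j + 1 < t → G.Adj (f j) (f (j + 1))

def IsCyc {V : Type*} (G : SimpleGraph V) (f : ℕ → V) (t : ℕ) : Prop :=
  IsPth G f t ∧ G.Adj (f (t - 1)) (f 0)

theorem pth_list {V : Type*} {G : SimpleGraph V} {f : ℕ → V} {t : ℕ} (h : IsPth G f t) :
    ((List.range t).map f).Nodup ∧ ((List.range t).map f).IsChain G.Adj := by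
  constructor
  · apply List.Nodup.map_on _ List.nodup_range
    intro x hx y hy hxy
    exact h.1 x y (by simpa using hx) (by simpa using hy) hxy
  · rw [List.isChain_iff_getElem]
    intro i hi
    simpa using h.2 i (by simpa using hi)

theorem cyc_has {V : Type*} {G : SimpleGraph V} {f : ℕ → V} {t : ℕ} (h : IsCyc G f t)
    (h3 : 3 ≤ t) : HasCycleLen G t := by
  have h1 := pth_list h.1
  have := cyc_of_list ((List.range t).map f) h1.1 h1.2 (by simpa using h3) (by
    intro x hx y hy
    have hx' : x = f (t - 1) := by
      rw [List.getLast?_eq_getElem?] at hx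
      simp only [List.length_map, List.length_range, Option.mem_def] at hx
      rw [List.getElem?_map, List.getElem?_range (by omega)] at hx
      simpa using hx.symm
    have hy' : y = f 0 := by
      rw [List.head?_eq_getElem?] at hy
      simp only [Option.mem_def] at hy
      rw [List.getElem?_map, List.getElem?_range (by omega)] at hy
      simpa using hy.symm
    rw [hx', hy']; exact h.2)
  simpa using this

theorem cyc_shift {V : Type*} {G : SimpleGraph V} {f : ℕ → V} {t : ℕ} (h : IsCyc G f t)
    (c : ℕ) (ht : 0 < t) : IsCyc G (fun i => f ((i + c) % t)) t := by
  have key : ∀ j, G.Adj (f (j % t)) (f ((j + 1) % t)) := by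
    intro j
    have hm := Nat.mod_lt j ht
    by_cases hj : j % t + 1 < t
    · have : (j + 1) % t = j % t + 1 := by
        rw [Nat.add_mod, Nat.mod_eq_of_lt (a := 1) (by omega), Nat.mod_eq_of_lt hj]
      rw [this]; exact h.1.2 _ hj
    · have h1 : j % t = t - 1 := by omega
      have : (j + 1) % t = 0 := by
        rw [← Nat.dvd_iff_mod_eq_zero]
        refine ⟨j / t + 1, ?_⟩
        have := Nat.div_add_mod j t
        rw [mul_add]; omega
      rw [this, h1]; exact h.2
  refine ⟨⟨?_, ?_⟩, ?_⟩
  · intro i j hi hj hij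
    have := h.1.1 _ _ (Nat.mod_lt _ ht) (Nat.mod_lt _ ht) hij
    have h2 : i ≡ j [MOD t] := Nat.ModEq.add_right_cancel' c this
    have := Nat.ModEq.eq_of_lt_of_lt h2 hi hj
    exact this
  · intro j hj
    have := key (j + c)
    have e : j + 1 + c = j + c + 1 := by omega
    simp only [e]; exact this
  · have := key (t - 1 + c)
    have e : t - 1 + c + 1 = c + t := by omega
    rw [e, Nat.add_mod_right] at this
    simpa using this

/-- crossing lemma -/
theorem crossing {V : Type*} {G : SimpleGraph V} {f : ℕ → V} {t i : ℕ} (h : IsPth G f t)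
    (hi : i + 1 < t) (h0 : G.Adj (f 0) (f (i + 1))) (h1 : G.Adj (f (t - 1)) (f i)) :
    IsCyc G (fun j => f (if j ≤ i then j else t + i - j)) t := by
  refine ⟨⟨?_, ?_⟩, ?_⟩
  · intro a b ha hb hab
    have := h.1 _ _ (by split_ifs <;> omega) (by split_ifs <;> omega) hab
    split_ifs at this <;> omega
  · intro j hj
    rcases lt_trichotomy j i with hji | hji | hji
    · simp only [hji.le, Nat.succ_le_of_lt hji, if_true]
      exact h.2 j hj
    · subst hji
      simp only [le_refl, if_true, show ¬ (j + 1 ≤ j) by omega, if_false]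
      rw [show t + j - (j + 1) = t - 1 by omega]
      exact h1.symm
    · simp only [show ¬ (j ≤ i) by omega, show ¬ (j + 1 ≤ i) by omega, if_false]
      have := h.2 (t + i - (j + 1)) (by omega)
      rw [show t + i - (j + 1) + 1 = t + i - j by omega] at this
      exact this.symm
  · simp only [show ¬ (t - 1 ≤ i) by omega, if_false, Nat.zero_le, if_true]
    rw [show t + i - (t - 1) = i + 1 by omega]
    exact h0.symm

/-- neighbours of `x` inside `U` -/
noncomputable def nb {V : Type*} (G : SimpleGraph V) (U : Finset V) (x : V) : Finset V :=
  U.filter (fun y => G.Adj x y)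

theorem mem_nb {V : Type*} {G : SimpleGraph V} {U : Finset V} {x y : V} :
    y ∈ nb G U x ↔ y ∈ U ∧ G.Adj x y := by simp [nb]

theorem nb_mono {V : Type*} {G : SimpleGraph V} {U W : Finset V} (h : U ⊆ W) (x : V) :
    nb G U x ⊆ nb G W x := Finset.filter_subset_filter _ h

/-- if degrees of the ends inside the path sum to at least `t`, a crossing exists -/
theorem exists_cyc {V : Type*} {G : SimpleGraph V} {f : ℕ → V} {t : ℕ} (h : IsPth G f t)
    (ht : 2 ≤ t)
    (hd : t ≤ (nb G ((Finset.range t).image f) (f 0)).card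
      + (nb G ((Finset.range t).image f) (f (t - 1))).card) :
    ∃ g, IsCyc G g t ∧ (Finset.range t).image g = (Finset.range t).image f := by
  set S := (Finset.range (t - 1)).filter (fun i => G.Adj (f 0) (f (i + 1))) with hS
  set S' := (Finset.range (t - 1)).filter (fun i => G.Adj (f (t - 1)) (f i)) with hS'
  have c1 : (nb G ((Finset.range t).image f) (f 0)).card ≤ S.card := by
    calc _ ≤ (S.image (fun i => f (i + 1))).card := by
          apply Finset.card_le_card
          intro y hy
          rw [mem_nb, Finset.mem_image] at hy
          obtain ⟨⟨j, hj, rfl⟩, ha⟩ := hy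
          have : j ≠ 0 := by rintro rfl; exact ha.ne rfl
          simp only [Finset.mem_range] at hj
          rw [Finset.mem_image]
          refine ⟨j - 1, ?_, by congr 1; omega⟩
          simp only [hS, Finset.mem_filter, Finset.mem_range]
          refine ⟨by omega, ?_⟩
          rwa [show j - 1 + 1 = j by omega]
      _ ≤ _ := Finset.card_image_le
  have c2 : (nb G ((Finset.range t).image f) (f (t - 1))).card ≤ S'.card := by
    calc _ ≤ (S'.image f).card := by
          apply Finset.card_le_card
          intro y hy
          rw [mem_nb, Finset.mem_image] at hy
          obtain ⟨⟨j, hj, rfl⟩, ha⟩ := hy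
          have : j ≠ t - 1 := by rintro rfl; exact ha.ne rfl
          simp only [Finset.mem_range] at hj
          rw [Finset.mem_image]
          refine ⟨j, ?_, rfl⟩
          simp only [hS', Finset.mem_filter, Finset.mem_range]
          exact ⟨by omega, ha⟩
      _ ≤ _ := Finset.card_image_le
  have : ¬ Disjoint S S' := by
    intro hdis
    have h1 := Finset.card_union_of_disjoint hdis
    have h2 : (S ∪ S').card ≤ (Finset.range (t - 1)).card :=
      Finset.card_le_card (Finset.union_subset (Finset.filter_subset _ _) (Finset.filter_subset _ _))
    simp only [Finset.card_range] at h2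
    omega
  rw [Finset.not_disjoint_iff] at this
  obtain ⟨i, hi1, hi2⟩ := this
  simp only [hS, hS', Finset.mem_filter, Finset.mem_range] at hi1 hi2
  refine ⟨_, crossing h (by omega) hi1.2 hi2.2, ?_⟩
  ext y
  simp only [Finset.mem_image, Finset.mem_range]
  constructor
  · rintro ⟨j, hj, rfl⟩
    exact ⟨_, by split_ifs <;> omega, rfl⟩
  · rintro ⟨j, hj, rfl⟩
    by_cases hji : j ≤ i
    · exact ⟨j, hj, by simp [hji]⟩
    · refine ⟨t + i - j, by omega, ?_⟩
      have : ¬ (t + i - j ≤ i) := by omega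
      simp only [this, if_false]
      congr 1; omega

theorem card_pth {V : Type*} {G : SimpleGraph V} {f : ℕ → V} {t : ℕ} (h : IsPth G f t) :
    ((Finset.range t).image f).card = t := by
  rw [Finset.card_image_of_injOn, Finset.card_range]
  intro i hi j hj hij
  exact h.1 i j (by simpa using hi) (by simpa using hj) hij

theorem image_shift {V : Type*} {G : SimpleGraph V} {f : ℕ → V} {t : ℕ} (h : IsCyc G f t)
    (c : ℕ) (ht : 0 < t) :
    (Finset.range t).image (fun i => f ((i + c) % t)) = (Finset.range t).image f := by
  apply Finset.eq_of_subset_of_card_le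
  · intro y hy
    simp only [Finset.mem_image, Finset.mem_range] at hy ⊢
    obtain ⟨i, hi, rfl⟩ := hy
    exact ⟨_, Nat.mod_lt _ ht, rfl⟩
  · rw [card_pth h.1, card_pth (cyc_shift h c ht).1]

theorem closure1 {V : Type*} {G H : SimpleGraph V} {T : Finset V} {n : ℕ} (hn : 3 ≤ n) {u v : V}
    (hH : ∀ x y, H.Adj x y → G.Adj x y ∨ (x = u ∧ y = v) ∨ (x = v ∧ y = u))
    (hdeg : n ≤ (nb G T u).card + (nb G T v).card) {f : ℕ → V} (hf : IsCyc H f n)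
    (hT : (Finset.range n).image f = T) :
    ∃ g, IsCyc G g n ∧ (Finset.range n).image g = T := by
  have key : ∀ g, IsCyc H g n → (Finset.range n).image g = T → ¬ G.Adj (g (n - 1)) (g 0) →
      ∃ g, IsCyc G g n ∧ (Finset.range n).image g = T := by
    intro g hg hgT hna
    have hends := (hH _ _ hg.2).resolve_left hna
    have hp : IsPth G g n := by
      refine ⟨hg.1.1, ?_⟩
      intro j hj
      rcases hH _ _ (hg.1.2 j hj) with h | h
      · exact h
      · exfalso
        have e1 : g j = g (n - 1) ∧ g (j + 1) = g 0 ∨ g j = g 0 ∧ g (j + 1) = g (n - 1) := by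
          rcases h with ⟨h1, h2⟩ | ⟨h1, h2⟩ <;> rcases hends with ⟨h3, h4⟩ | ⟨h3, h4⟩ <;>
            simp [h1, h2, h3, h4]
        rcases e1 with ⟨h1, h2⟩ | ⟨h1, h2⟩
        · have := hg.1.1 _ _ (by omega) (by omega) h2
          omega
        · have h3 := hg.1.1 _ _ (by omega) (by omega) h2
          have h4 := hg.1.1 _ _ (by omega) (by omega) h1
          omega
    have hd : n ≤ (nb G ((Finset.range n).image g) (g 0)).card
      + (nb G ((Finset.range n).image g) (g (n - 1))).card := by
      rw [hgT]
      rcases hends with ⟨h3, h4⟩ | ⟨h3, h4⟩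
      · rw [h3, h4]; omega
      · rw [h3, h4]; omega
    obtain ⟨g', h1, h2⟩ := exists_cyc hp (by omega) hd
    exact ⟨g', h1, by rw [h2, hgT]⟩
  by_cases hl : G.Adj (f (n - 1)) (f 0)
  · by_cases hall : ∀ j, j + 1 < n → G.Adj (f j) (f (j + 1))
    · exact ⟨f, ⟨⟨hf.1.1, hall⟩, hl⟩, hT⟩
    · push Not at hall
      obtain ⟨j, hj, hna⟩ := hall
      apply key _ (cyc_shift hf (j + 1) (by omega))
      · rw [image_shift hf _ (by omega), hT]
      · rw [show n - 1 + (j + 1) = j + n by omega, Nat.add_mod_right, Nat.mod_eq_of_lt (by omega),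
          Nat.zero_add, Nat.mod_eq_of_lt (by omega)]
        exact hna
  · exact key f hf hT hl

theorem nb_graph_mono {V : Type*} {G H : SimpleGraph V} (h : G ≤ H) (U : Finset V) (x : V) :
    (nb G U x).card ≤ (nb H U x).card := by
  apply Finset.card_le_card
  intro y hy
  rw [mem_nb] at *
  exact ⟨hy.1, h hy.2⟩

theorem ham_of {V : Type*} (T A : Finset V) (n : ℕ) (hTn : T.card = n) (hn : 3 ≤ n) (hA : A ⊆ T)
    (α β : ℕ) (hab : n ≤ α + β) (hA2 : n ≤ 2 * A.card) : ∀ (m : ℕ) (G : SimpleGraph V),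
    ((T ×ˢ T).filter (fun p => p.1 ≠ p.2 ∧ ¬ G.Adj p.1 p.2)).card ≤ m →
    (∀ a ∈ A, α ≤ (nb G T a).card) → (∀ x ∈ T, β ≤ (nb G T x).card) →
    ∃ g, IsCyc G g n ∧ (Finset.range n).image g = T := by
  intro m
  induction m with
  | zero =>
    intro G hm _ _
    have hall : ∀ x ∈ T, ∀ y ∈ T, x ≠ y → G.Adj x y := by
      intro x hx y hy hxy
      by_contra hna
      have : (x, y) ∈ ((T ×ˢ T).filter (fun p => p.1 ≠ p.2 ∧ ¬ G.Adj p.1 p.2)) := by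
        simp [hx, hy, hxy, hna]
      rw [Finset.card_eq_zero.1 (Nat.le_zero.1 hm)] at this
      simp at this
    have hne : T.Nonempty := Finset.card_pos.1 (by omega)
    obtain ⟨x0, _⟩ := hne
    let e := T.equivFinOfCardEq hTn
    let f : ℕ → V := fun i => if h : i < n then (e.symm ⟨i, h⟩ : V) else x0
    have hfT : ∀ i, i < n → f i ∈ T := by
      intro i hi
      simp only [f, hi, dif_pos]
      exact (e.symm ⟨i, hi⟩).2
    have hinj : ∀ i j, i < n → j < n → f i = f j → i = j := by
      intro i j hi hj hij
      simp only [f, hi, hj, dif_pos] at hij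
      have := e.symm.injective (Subtype.ext hij)
      simpa using this
    have hcyc : IsCyc G f n := by
      refine ⟨⟨hinj, ?_⟩, ?_⟩
      · intro j hj
        apply hall _ (hfT _ (by omega)) _ (hfT _ hj)
        intro h
        have := hinj _ _ (by omega) (by omega) h
        omega
      · apply hall _ (hfT _ (by omega)) _ (hfT _ (by omega))
        intro h
        have := hinj _ _ (by omega) (by omega) h
        omega
    refine ⟨f, hcyc, ?_⟩
    apply Finset.eq_of_subset_of_card_le
    · intro y hy
      simp only [Finset.mem_image, Finset.mem_range] at hy
      obtain ⟨i, hi, rfl⟩ := hy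
      exact hfT i hi
    · rw [card_pth hcyc.1, hTn]
  | succ m ih =>
    intro G hm hα hβ
    by_cases hall : ∀ x ∈ T, ∀ y ∈ T, x ≠ y → G.Adj x y
    · apply ih G _ hα hβ
      rw [Finset.card_eq_zero.2]
      · omega
      · rw [Finset.filter_eq_empty_iff]
        rintro ⟨x, y⟩ hp ⟨h1, h2⟩
        rw [Finset.mem_product] at hp
        exact h2 (hall x hp.1 y hp.2 h1)
    · obtain ⟨u, hu, v, hv, huv, hna, hd⟩ : ∃ u ∈ T, ∃ v ∈ T, u ≠ v ∧ ¬ G.Adj u v ∧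
          n ≤ (nb G T u).card + (nb G T v).card := by
        by_cases hu : ∀ a ∈ A, ∀ y ∈ T, a ≠ y → G.Adj a y
        · push Not at hall
          obtain ⟨x, hx, y, hy, hxy, hna⟩ := hall
          refine ⟨x, hx, y, hy, hxy, hna, ?_⟩
          have hxA : x ∉ A := fun h => hna (hu x h y hy hxy)
          have hyA : y ∉ A := fun h => hna (hu y h x hx hxy.symm).symm
          have h1 : A.card ≤ (nb G T x).card := by
            apply Finset.card_le_card
            intro a ha
            rw [mem_nb]
            exact ⟨hA ha, (hu a ha x hx (by rintro rfl; exact hxA ha)).symm⟩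
          have h2 : A.card ≤ (nb G T y).card := by
            apply Finset.card_le_card
            intro a ha
            rw [mem_nb]
            exact ⟨hA ha, (hu a ha y hy (by rintro rfl; exact hyA ha)).symm⟩
          omega
        · push Not at hu
          obtain ⟨a, ha, y, hy, hay, hna⟩ := hu
          refine ⟨a, hA ha, y, hy, hay, hna, ?_⟩
          have := hα a ha
          have := hβ y hy
          omega
      have hle : G ≤ G ⊔ SimpleGraph.edge u v := le_sup_left
      obtain ⟨f, hf, hfT⟩ := ih (G ⊔ SimpleGraph.edge u v) (by
          have : ((T ×ˢ T).filter
              (fun p => p.1 ≠ p.2 ∧ ¬ (G ⊔ SimpleGraph.edge u v).Adj p.1 p.2)) ⊂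
              ((T ×ˢ T).filter (fun p => p.1 ≠ p.2 ∧ ¬ G.Adj p.1 p.2)) := by
            rw [Finset.ssubset_iff_of_subset]
            · refine ⟨(u, v), by simp [hu, hv, huv, hna], ?_⟩
              simp [SimpleGraph.edge_adj, huv]
            · intro p hp
              rw [Finset.mem_filter] at *
              exact ⟨hp.1, hp.2.1, fun h => hp.2.2 (hle h)⟩
          have h2 := Finset.card_lt_card this
          refine le_trans (le_of_eq ?_) (Nat.le_of_lt_succ (lt_of_lt_of_le h2 hm))
          congr!)
        (fun a ha => (hα a ha).trans (nb_graph_mono hle _ _))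
        (fun a ha => (hβ a ha).trans (nb_graph_mono hle _ _))
      apply closure1 hn _ hd hf hfT
      intro x y hxy
      rw [SimpleGraph.sup_adj, SimpleGraph.edge_adj] at hxy
      rcases hxy with h | h
      · exact Or.inl h
      · right
        have := h.1
        tauto

theorem pth_prepend {V : Type*} {G : SimpleGraph V} {f : ℕ → V} {t : ℕ} (h : IsPth G f t)
    {z : V} (hz : ∀ i < t, f i ≠ z) (ha : G.Adj z (f 0)) :
    IsPth G (fun i => if i = 0 then z else f (i - 1)) (t + 1) := by
  constructor
  · intro i j hi hj hij
    by_cases h0 : i = 0 <;> by_cases h1 : j = 0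
    · omega
    · simp only [h0, h1, if_true, if_false] at hij
      exact absurd hij.symm (hz _ (by omega))
    · simp only [h0, h1, if_true, if_false] at hij
      exact absurd hij (hz _ (by omega))
    · simp only [h0, h1, if_false] at hij
      have := h.1 _ _ (by omega) (by omega) hij
      omega
  · intro j hj
    by_cases h0 : j = 0
    · simp [h0, ha]
    · simp only [h0, if_false, Nat.add_one_ne_zero, Nat.add_sub_cancel]
      have := h.2 (j - 1) (by omega)
      rwa [show j - 1 + 1 = j by omega] at this

theorem pth_rev {V : Type*} {G : SimpleGraph V} {f : ℕ → V} {t : ℕ} (h : IsPth G f t) :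
    IsPth G (fun i => f (t - 1 - i)) t := by
  constructor
  · intro i j hi hj hij
    have := h.1 _ _ (by omega) (by omega) hij
    omega
  · intro j hj
    have := h.2 (t - 1 - (j + 1)) (by omega)
    rw [show t - 1 - (j + 1) + 1 = t - 1 - j by omega] at this
    exact this.symm

theorem long_path {V : Type*} {G : SimpleGraph V} (X : Finset V) (d : ℕ)
    (hd : ∀ x ∈ X, d ≤ (nb G X x).card) (hne : X.Nonempty)
    (conn : ∀ P, P ⊆ X → P.Nonempty → P ≠ X → ∃ p ∈ P, ∃ z ∈ X, z ∉ P ∧ G.Adj p z) :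
    ∀ t, 1 ≤ t → t ≤ X.card → t ≤ 2 * d + 1 → ∃ f, IsPth G f t ∧ ∀ i < t, f i ∈ X := by
  intro t ht
  induction t, ht using Nat.le_induction with
  | base =>
    intro _ _
    obtain ⟨x, hx⟩ := hne
    exact ⟨fun _ => x, ⟨fun i j _ _ _ => by omega, fun j _ => by omega⟩, fun _ _ => hx⟩
  | succ t ht ih =>
    intro htX htd
    obtain ⟨f, hf, hfX⟩ := ih (by omega) (by omega)
    have ext : ∀ g, IsPth G g t → (∀ i < t, g i ∈ X) →
        (∃ z ∈ X, z ∉ (Finset.range t).image g ∧ G.Adj (g 0) z) →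
        ∃ f, IsPth G f (t + 1) ∧ ∀ i < t + 1, f i ∈ X := by
      rintro g hg hgX ⟨z, hz, hzn, hza⟩
      refine ⟨_, pth_prepend hg (z := z) ?_ hza.symm, ?_⟩
      · intro i hi h
        exact hzn (Finset.mem_image.2 ⟨i, Finset.mem_range.2 hi, h⟩)
      · intro i hi
        by_cases h0 : i = 0
        · simpa [h0] using hz
        · simp only [h0, if_false]
          exact hgX _ (by omega)
    set P := (Finset.range t).image f with hP
    have hPX : P ⊆ X := by
      intro y hy
      simp only [hP, Finset.mem_image, Finset.mem_range] at hy
      obtain ⟨i, hi, rfl⟩ := hy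
      exact hfX i hi
    by_cases h0 : ∃ z ∈ X, z ∉ P ∧ G.Adj (f 0) z
    · exact ext f hf hfX h0
    by_cases h1 : ∃ z ∈ X, z ∉ P ∧ G.Adj (f (t - 1)) z
    · apply ext _ (pth_rev hf) (fun i hi => hfX _ (by omega))
      obtain ⟨z, hz, hzn, hza⟩ := h1
      refine ⟨z, hz, ?_, by simpa using hza⟩
      intro hh
      apply hzn
      simp only [hP, Finset.mem_image, Finset.mem_range] at hh ⊢
      obtain ⟨i, hi, rfl⟩ := hh
      exact ⟨_, by omega, rfl⟩
    push Not at h0 h1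
    have hdeg : ∀ i < t, (∀ z ∈ X, z ∉ P → ¬ G.Adj (f i) z) → d ≤ (nb G P (f i)).card := by
      intro i hi h
      refine (hd _ (hfX i hi)).trans (Finset.card_le_card ?_)
      intro y hy
      rw [mem_nb] at *
      refine ⟨?_, hy.2⟩
      by_contra hyP
      exact h y hy.1 hyP hy.2
    have d0 := hdeg 0 (by omega) h0
    have d1 := hdeg (t - 1) (by omega) h1
    have hPc : P.card = t := card_pth hf
    have ht2 : 2 ≤ t := by
      by_contra hlt
      have : t = 1 := by omega
      subst this
      have : (nb G P (f 0)).card = 0 := by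
        rw [Finset.card_eq_zero, Finset.eq_empty_iff_forall_notMem]
        intro y hy
        rw [mem_nb] at hy
        simp [hP] at hy
        exact hy.2.ne hy.1.symm
      omega
    obtain ⟨g, hg, hgP⟩ := exists_cyc hf ht2 (by rw [← hP]; omega)
    obtain ⟨p, hp, z, hz, hzP, hpz⟩ := conn P hPX ⟨f 0, by
      simp only [hP, Finset.mem_image, Finset.mem_range]; exact ⟨0, by omega, rfl⟩⟩ (by
      intro h; rw [h] at hPc; omega)
    have hp' := hp
    rw [← hP] at hgP
    rw [← hgP] at hp'
    simp only [Finset.mem_image, Finset.mem_range] at hp'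
    obtain ⟨c, hc, rfl⟩ := hp'
    have himg := image_shift hg c (by omega)
    rw [hgP] at himg
    apply ext _ (cyc_shift hg c (by omega)).1
    · intro i hi
      apply hPX
      rw [← himg]
      exact Finset.mem_image.2 ⟨i, Finset.mem_range.2 hi, rfl⟩
    · refine ⟨z, hz, by rw [himg]; exact hzP, ?_⟩
      simp only [Nat.zero_add, Nat.mod_eq_of_lt hc]
      exact hpz

theorem finish {V : Type*} [Fintype V] {G : SimpleGraph V} (K n t : ℕ) (hK : 1 ≤ K)
    (hN : Fintype.card V = K * (n - 1) + 1) (hdeg : ∀ v, n - 1 ≤ (nb G Finset.univ v).card)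
    (Bd : Finset V) (hb : (K + 2) * (Bd.card + 1) + 1 ≤ n) (ht1 : 1 ≤ t) (htn : t ≤ n)
    (hno : ¬ ∃ f, IsPth G f t ∧ ∀ i < t, f i ∉ Bd) : ∃ g, IsCyc G g n := by
  set b := Bd.card with hbdef
  let W : Finset V := Finset.univ \ Bd
  have hW : ∀ x, x ∈ W ↔ x ∉ Bd := by intro x; simp [W]
  let H : SimpleGraph V :=
    { Adj := fun u v => G.Adj u v ∧ u ∉ Bd ∧ v ∉ Bd
      symm := ⟨fun u v h => ⟨h.1.symm, h.2.2, h.2.1⟩⟩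
      loopless := ⟨fun u h => h.1.ne rfl⟩ }
  let κ : V → H.ConnectedComponent := H.connectedComponentMk
  have hκ : ∀ u v, G.Adj u v → u ∈ W → v ∈ W → κ u = κ v := by
    intro u v huv hu hv
    apply SimpleGraph.ConnectedComponent.sound
    apply SimpleGraph.Adj.reachable
    exact ⟨huv, (hW u).1 hu, (hW v).1 hv⟩
  have hb3 : K * (b + 1) + 2 * (b + 1) + 1 ≤ n := by
    have : (K + 2) * (b + 1) = K * (b + 1) + 2 * (b + 1) := by ring
    omega
  have hKb : b + 1 ≤ K * (b + 1) := Nat.le_mul_of_pos_left _ hK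
  have hdW : ∀ v, n - 1 - b ≤ (nb G W v).card := by
    intro v
    have : nb G Finset.univ v ⊆ nb G W v ∪ Bd := by
      intro y hy
      rw [Finset.mem_union, mem_nb, hW]
      rw [mem_nb] at hy
      tauto
    have := Finset.card_le_card this
    have h2 := Finset.card_union_le (nb G W v) Bd
    have := hdeg v
    omega
  let X : H.ConnectedComponent → Finset V := fun c => W.filter (fun x => κ x = c)
  have hX : ∀ c x, x ∈ X c ↔ x ∈ W ∧ κ x = c := by intro c x; simp [X]
  have hdX : ∀ c, ∀ x ∈ X c, n - 1 - b ≤ (nb G (X c) x).card := by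
    intro c x hx
    refine (hdW x).trans (Finset.card_le_card ?_)
    intro y hy
    rw [mem_nb] at *
    rw [hX] at *
    exact ⟨⟨hy.1, by rw [← hκ x y hy.2 hx.1 hy.1]; exact hx.2⟩, hy.2⟩
  have hXc : ∀ c, (X c).Nonempty → n - b ≤ (X c).card := by
    rintro c ⟨x, hx⟩
    have h1 := hdX c x hx
    have h2 : (nb G (X c) x).card < (X c).card := by
      apply Finset.card_lt_card
      have hsub : nb G (X c) x ⊆ X c := fun y hy => (mem_nb.1 hy).1
      rw [Finset.ssubset_iff_of_subset hsub]
      exact ⟨x, hx, fun h => (mem_nb.1 h).2.ne rfl⟩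
    omega
  let C := W.image κ
  have hCne : ∀ c ∈ C, (X c).Nonempty := by
    intro c hc
    obtain ⟨x, hx, rfl⟩ := Finset.mem_image.1 hc
    exact ⟨x, (hX _ _).2 ⟨hx, rfl⟩⟩
  have hCK : C.card ≤ K := by
    by_contra hlt
    have h1 : C.card * (n - b) ≤ ∑ c ∈ C, (X c).card := by
      rw [← smul_eq_mul]
      exact Finset.card_nsmul_le_sum _ _ _ (fun c hc => hXc c (hCne c hc))
    have h2 : W.card = ∑ c ∈ C, (X c).card :=
      Finset.card_eq_sum_card_fiberwise (fun x hx => Finset.mem_image_of_mem _ hx)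
    have h3 : W.card ≤ Fintype.card V := Finset.card_le_univ _
    have h4 : (K + 1) * (n - b) ≤ C.card * (n - b) := Nat.mul_le_mul_right _ (by omega)
    rw [hN] at h3
    obtain ⟨r, hr⟩ : ∃ r, n = b + 1 + r := ⟨n - (b + 1), by omega⟩
    have e1 : n - b = r + 1 := by omega
    have e2 : n - 1 = b + r := by omega
    rw [e1] at h4 h1
    rw [e2] at h3
    have : (K + 1) * (r + 1) ≤ K * (b + r) + 1 := by omega
    have e3 : (K + 1) * (r + 1) = K * r + K + r + 1 := by ring
    have e4 : K * (b + r) = K * b + K * r := by ring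
    have e5 : K * (b + 1) = K * b + K := by ring
    omega
  have hWne : W.Nonempty := by
    have : 0 < Fintype.card V := by omega
    obtain ⟨v⟩ := Fintype.card_pos_iff.1 this
    have h1 := hdW v
    have : 0 < (nb G W v).card := by omega
    obtain ⟨y, hy⟩ := Finset.card_pos.1 this
    exact ⟨y, (mem_nb.1 hy).1⟩
  have hCne' : C.Nonempty := hWne.image _
  set β := b + 1 with hβ
  have hasg : ∀ z, ∃ c ∈ C, β ≤ (nb G (X c) z).card := by
    intro z
    obtain ⟨c, hc, hcc⟩ := Finset.exists_le_card_fiber_of_mul_le_card_of_maps_to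
      (s := nb G W z) (t := C) (f := κ) (n := β)
      (fun a ha => Finset.mem_image_of_mem _ (mem_nb.1 ha).1) hCne' (by
        have h1 : C.card * β ≤ K * β := Nat.mul_le_mul_right _ hCK
        have := hdW z
        omega)
    refine ⟨c, hc, hcc.trans (Finset.card_le_card ?_)⟩
    intro y hy
    rw [Finset.mem_filter, mem_nb] at hy
    rw [mem_nb, hX]
    tauto
  choose asg hasgC hasgd using hasg
  obtain ⟨c, hc, hcn⟩ := Finset.exists_lt_card_fiber_of_mul_lt_card_of_maps_to
    (s := (Finset.univ : Finset V)) (t := C) (f := asg) (n := n - 1) (fun a _ => hasgC a) (by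
      have h1 : C.card * (n - 1) ≤ K * (n - 1) := Nat.mul_le_mul_right _ hCK
      rw [Finset.card_univ, hN]; omega)
  have hXF : X c ⊆ Finset.univ.filter (fun z => asg z = c) := by
    intro x hx
    rw [hX] at hx
    simp only [Finset.mem_filter, Finset.mem_univ, true_and]
    have h1 := hasgd x
    have : 0 < (nb G (X (asg x)) x).card := by omega
    obtain ⟨y, hy⟩ := Finset.card_pos.1 this
    rw [mem_nb, hX] at hy
    rw [← hy.1.2, ← hx.2]
    exact (hκ x y hy.2 hx.1 hy.1.1).symm
  have hXn : (X c).card ≤ n := by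
    by_contra hlt
    apply hno
    obtain ⟨f, hf, hfX⟩ := long_path (X c) (n - 1 - b) (hdX c) (hCne c hc) (by
      intro P hPX hPne hPX'
      by_contra hcon
      push Not at hcon
      obtain ⟨p, hp⟩ := hPne
      have hcl : ∀ u v, H.Walk u v → u ∈ P → v ∈ P := by
        intro u v w
        induction w with
        | nil => exact id
        | cons h w ih =>
          rename_i u v w'
          intro hu
          apply ih
          by_contra hvn
          have huX := (hX _ _).1 (hPX hu)
          have hvW := (hW v).2 h.2.2
          refine hcon u hu v ((hX _ _).2 ⟨hvW, ?_⟩) hvn h.1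
          rw [← hκ u v h.1 huX.1 hvW]; exact huX.2
      apply hPX'
      apply Finset.Subset.antisymm hPX
      intro x hx
      have e : κ p = κ x := by rw [((hX _ _).1 hx).2, ((hX _ _).1 (hPX hp)).2]
      obtain ⟨w⟩ := SimpleGraph.ConnectedComponent.exact e
      exact hcl p x w hp) t ht1 (by omega) (by omega)
    exact ⟨f, hf, fun i hi => (hW _).1 ((hX _ _).1 (hfX i hi)).1⟩
  obtain ⟨T, hXT, hTF, hTn⟩ := Finset.exists_subsuperset_card_eq hXF hXn (by omega)
  obtain ⟨g, hg, _⟩ := ham_of T (X c) n hTn (by omega) hXT (n - 1 - b) β (by omega)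
    (by have := hXc c (hCne c hc); omega) _ G le_rfl
    (fun a ha => (hdX c a ha).trans (Finset.card_le_card (nb_mono hXT a)))
    (fun x hx => by
      have h1 := hasgd x
      have h2 : asg x = c := by simpa using hTF hx
      rw [h2] at h1
      exact h1.trans (Finset.card_le_card (nb_mono hXT x)))
  exact ⟨g, hg⟩

theorem nb_sum {V : Type*} (G : SimpleGraph V) (U M : Finset V) :
    ∑ x ∈ M, (nb G U x).card = ∑ y ∈ U, (nb G M y).card := by
  have h := Finset.sum_card_bipartiteAbove_eq_sum_card_bipartiteBelow (s := M) (t := U) (fun x y => G.Adj x y)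
  have e1 : ∀ x, nb G U x = Finset.bipartiteAbove (fun x y => G.Adj x y) U x := by
    intro x; ext y; simp [mem_nb, Finset.bipartiteAbove]
  have e2 : ∀ x, nb G M x = Finset.bipartiteBelow (fun x y => G.Adj x y) M x := by
    intro x; ext y; simp [mem_nb, Finset.bipartiteBelow, SimpleGraph.adj_comm]
  simp only [e1, e2]
  exact h

theorem cover {V : Type*} {G : SimpleGraph V} (U M : Finset V) (d J : ℕ) (hd : 0 < d)
    (hM : M.Nonempty) (hdeg : ∀ x ∈ M, d ≤ (nb G U x).card) (hJ : 2 * J * U.card ≤ M.card * d) :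
    ∃ T ⊆ M, J ≤ T.card ∧
      d ≤ 2 ^ (M.card + 1) * (U.filter (fun y => ∀ x ∈ T, G.Adj x y)).card := by
  set P := U.filter (fun y => J ≤ (nb G M y).card) with hP
  have hMp : 0 < M.card := hM.card_pos
  have h1 : M.card * d ≤ ∑ x ∈ M, (nb G U x).card := by
    rw [← smul_eq_mul]; exact Finset.card_nsmul_le_sum _ _ _ hdeg
  have h2 : ∑ y ∈ U, (nb G M y).card ≤ P.card * M.card + J * U.card := by
    rw [← Finset.sum_filter_add_sum_filter_not U (fun y => J ≤ (nb G M y).card)]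
    apply Nat.add_le_add
    · rw [← smul_eq_mul]
      exact Finset.sum_le_card_nsmul _ _ _ (fun y _ => Finset.card_le_card (fun z hz => (mem_nb.1 hz).1))
    · calc _ ≤ (U.filter (fun y => ¬ J ≤ (nb G M y).card)).card • J := by
            apply Finset.sum_le_card_nsmul
            intro y hy
            have := (Finset.mem_filter.1 hy).2
            omega
        _ ≤ J * U.card := by
            rw [smul_eq_mul, mul_comm]
            exact Nat.mul_le_mul_left _ (Finset.card_le_card (Finset.filter_subset _ _))
  rw [nb_sum] at h1
  have h3 : d ≤ 2 * P.card := by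
    have : M.card * d ≤ M.card * (2 * P.card) := by nlinarith
    exact Nat.le_of_mul_le_mul_left this hMp
  by_contra hcon
  push Not at hcon
  have h4 : P.card = ∑ T ∈ M.powerset, (P.filter (fun y => nb G M y = T)).card :=
    Finset.card_eq_sum_card_fiberwise (fun y _ => Finset.mem_powerset.2 (fun z hz => (mem_nb.1 hz).1))
  have h5 : ∀ T ∈ M.powerset, 2 ^ (M.card + 1) * (P.filter (fun y => nb G M y = T)).card ≤ d - 1 := by
    intro T hT
    rcases Finset.eq_empty_or_nonempty (P.filter (fun y => nb G M y = T)) with he | ⟨y, hy⟩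
    · rw [he]; simp
    · rw [Finset.mem_filter, hP, Finset.mem_filter] at hy
      have := hcon T (Finset.mem_powerset.1 hT) (by rw [← hy.2]; exact hy.1.2)
      have hle : (P.filter (fun y => nb G M y = T)).card ≤
          (U.filter (fun y => ∀ x ∈ T, G.Adj x y)).card := by
        apply Finset.card_le_card
        intro z hz
        rw [Finset.mem_filter, hP, Finset.mem_filter] at hz
        rw [Finset.mem_filter]
        refine ⟨hz.1.1, fun x hx => ?_⟩
        rw [← hz.2] at hx
        exact (mem_nb.1 hx).2.symm
      have := Nat.mul_le_mul_left (2 ^ (M.card + 1)) hle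
      omega
  have h6 := Finset.sum_le_card_nsmul _ _ _ h5
  rw [← Finset.mul_sum, ← h4, Finset.card_powerset, smul_eq_mul, pow_succ, mul_assoc] at h6
  have := Nat.le_of_mul_le_mul_left h6 (by positivity)
  omega

theorem hub_path {V : Type*} {G : SimpleGraph V} : ∀ (j : ℕ) (X Y : Finset V) (x1 x2 : V),
    (∀ x ∈ X, ∀ y ∈ Y, G.Adj x y) → x1 ∈ X → x2 ∈ X → x1 ≠ x2 → j + 2 ≤ X.card → j + 1 ≤ Y.card →
    ∃ l : List V, (x1 :: l).length = 2 * j + 3 ∧ (x1 :: l).Nodup ∧ (∀ x ∈ x1 :: l, x ∈ X ∪ Y) ∧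
      (x1 :: l).IsChain G.Adj ∧ (x1 :: l).getLast? = some x2 := by
  intro j
  induction j with
  | zero =>
    intro X Y x1 x2 hXY h1 h2 hne hX hY
    obtain ⟨y, hy⟩ := Finset.card_pos.1 (by omega : 0 < Y.card)
    have a1 := hXY x1 h1 y hy
    have a2 := hXY x2 h2 y hy
    refine ⟨[y, x2], by simp, ?_, ?_, ?_, by simp⟩
    · simp [a1.ne, a2.ne.symm, hne]
    · simp [h1, h2, hy]
    · simp [a1, a2.symm]
  | succ j ih =>
    intro X Y x1 x2 hXY h1 h2 hne hX hY
    obtain ⟨y, hy⟩ := Finset.card_pos.1 (by omega : 0 < Y.card)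
    have hx12 : ({x1, x2} : Finset V).card = 2 := Finset.card_pair hne
    have hsd := Finset.le_card_sdiff {x1, x2} X
    obtain ⟨x3, hx3⟩ := Finset.card_pos.1 (by omega : 0 < (X \ {x1, x2}).card)
    simp only [Finset.mem_sdiff, Finset.mem_insert, Finset.mem_singleton, not_or] at hx3
    obtain ⟨l, hl, hn, hm, hc, hla⟩ := ih (X.erase x1) (Y.erase y) x3 x2
      (fun x hx z hz => hXY x (Finset.mem_of_mem_erase hx) z (Finset.mem_of_mem_erase hz))
      (by simp [hx3]) (by simp [h2, hne.symm]) hx3.2.2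
      (by rw [Finset.card_erase_of_mem h1]; omega) (by rw [Finset.card_erase_of_mem hy]; omega)
    have hyX : y ∉ X := fun h => (hXY y h y hy).ne rfl
    have hxY : x1 ∉ Y := fun h => (hXY x1 h1 x1 h).ne rfl
    refine ⟨y :: x3 :: l, by simp at hl ⊢; omega, ?_, ?_, ?_, ?_⟩
    · rw [List.nodup_cons, List.nodup_cons]
      refine ⟨?_, ?_, hn⟩
      · rw [List.mem_cons, not_or]
        refine ⟨(hXY x1 h1 y hy).ne, fun h => ?_⟩
        have := hm _ h
        simp [hxY] at this
      · intro h
        have := hm _ h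
        simp [hyX] at this
    · intro x hx
      rw [List.mem_cons, List.mem_cons] at hx
      rcases hx with rfl | rfl | hx
      · simp [h1]
      · simp [hy]
      · have := hm x hx
        simp only [Finset.mem_union, Finset.mem_erase] at this ⊢
        tauto
    · rw [List.isChain_cons_cons, List.isChain_cons_cons]
      exact ⟨hXY x1 h1 y hy, (hXY x3 hx3.1 y hy).symm, hc⟩
    · rw [List.getLast?_cons_cons, List.getLast?_cons_cons]; exact hla

theorem cover' {V : Type*} {G : SimpleGraph V} (U M : Finset V) (d J : ℕ) (hd : 0 < d)
    (hM : M.Nonempty) (hdeg : ∀ x ∈ M, d ≤ (nb G U x).card) (hJ : 2 * J * U.card ≤ M.card * d) :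
    ∃ T ⊆ M, J ≤ T.card ∧ ∃ C ⊆ U, (∀ y ∈ C, ∀ x ∈ T, G.Adj x y) ∧
      d ≤ 2 ^ (M.card + 1) * C.card := by
  obtain ⟨T, h1, h2, h3⟩ := cover (G := G) U M d J hd hM hdeg hJ
  exact ⟨T, h1, h2, _, Finset.filter_subset _ _, fun y hy => (Finset.mem_filter.1 hy).2, h3⟩

def Lk {V : Type} (G : SimpleGraph V) (D : Finset V) (c : V → ℕ) (a b : ℕ) : Prop :=
  ∀ u v, u ∉ D → v ∉ D → u ≠ v → c u = c v → c u ≠ 0 → ∀ j, a ≤ j → j ≤ b →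
    ∃ l : List V, l.length + 1 = 2 * j ∧ l.Nodup ∧ (∀ x ∈ l, x ∈ D ∧ c x = c u) ∧
      (u :: (l ++ [v])).IsChain G.Adj

noncomputable def unc {V : Type} [Fintype V] (D : Finset V) (c : V → ℕ) : Finset V :=
  Finset.univ.filter (fun v => v ∉ D ∧ c v = 0)

theorem mem_unc {V : Type} [Fintype V] {D : Finset V} {c : V → ℕ} {v : V} :
    v ∈ unc D c ↔ v ∉ D ∧ c v = 0 := by simp [unc]

theorem hub_find {V : Type} [Fintype V] {G : SimpleGraph V} (K q J D0 n : ℕ) (hK : 1 ≤ K) (hq : 1 ≤ q)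
    (p s m : ℕ) (hp : p = 4 * K * q) (hs : s = 4 * K * p) (hm : m = 2 * J * K * p) (hJ : s ≤ J)
    (hcard : Fintype.card V ≤ K * n) (hdeg : ∀ v, n - 1 ≤ (nb G Finset.univ v).card)
    (D U : Finset V) (hD : D.card ≤ D0) (hU : n ≤ q * U.card)
    (hn1 : 4 * m + 4 + 4 * D0 ≤ n) (hn2 : p * (2 ^ (m + 1) * J) ≤ n) :
    ∃ X Y A : Finset V, ∃ x1 x2 : V, Disjoint X D ∧ Y ⊆ U ∧ A ⊆ U ∧ J ≤ X.card ∧ X.card ≤ m ∧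
      Y.card = J ∧ (∀ x ∈ X, ∀ y ∈ Y, G.Adj x y) ∧ x1 ∈ X ∧ x2 ∈ X ∧ x1 ≠ x2 ∧
      (∀ y ∈ A, G.Adj x1 y ∧ G.Adj x2 y) ∧ n ≤ p * 2 ^ (s + 1) * A.card := by
  have hp0 : 0 < p := by subst hp; positivity
  have hs0 : 0 < s := by subst hs; positivity
  have hUn : U.card ≤ K * n := (Finset.card_le_univ _).trans hcard
  have hU0 : 0 < U.card := by
    rcases Nat.eq_zero_or_pos U.card with h | h
    · rw [h] at hU; omega
    · exact h
  set R : Finset V := Finset.univ \ D with hR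
  have hRm : ∀ x, x ∈ R ↔ x ∉ D := by intro x; simp [hR]
  set W : Finset V := R.filter (fun x => n ≤ p * (nb G U x).card) with hW
  have hdR : ∀ v, n - 1 - D0 ≤ (nb G R v).card := by
    intro v
    have : nb G Finset.univ v ⊆ nb G R v ∪ D := by
      intro y hy
      rw [Finset.mem_union, mem_nb, hRm]
      rw [mem_nb] at hy
      tauto
    have := Finset.card_le_card this
    have h2 := Finset.card_union_le (nb G R v) D
    have := hdeg v
    omega
  have e1 : U.card * (n - 1 - D0) ≤ ∑ v ∈ U, (nb G R v).card := by
    rw [← smul_eq_mul]; exact Finset.card_nsmul_le_sum _ _ _ (fun v _ => hdR v)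
  have e2 : p * ∑ x ∈ R, (nb G U x).card ≤ p * (W.card * U.card) + K * n * n := by
    rw [← Finset.sum_filter_add_sum_filter_not R (fun x => n ≤ p * (nb G U x).card), mul_add]
    apply Nat.add_le_add
    · apply Nat.mul_le_mul_left
      rw [← smul_eq_mul]
      exact Finset.sum_le_card_nsmul _ _ _ (fun y _ => Finset.card_le_card (fun z hz => (mem_nb.1 hz).1))
    · rw [Finset.mul_sum]
      calc _ ≤ (R.filter (fun x => ¬ n ≤ p * (nb G U x).card)).card • n := by
            apply Finset.sum_le_card_nsmul
            intro y hy
            have := (Finset.mem_filter.1 hy).2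
            omega
        _ ≤ K * n * n := by
            rw [smul_eq_mul]
            exact Nat.mul_le_mul_right _ ((Finset.card_le_univ _).trans hcard)
  rw [nb_sum] at e2
  have e3 : K * n * n ≤ K * n * (q * U.card) := Nat.mul_le_mul_left _ hU
  have hWm : m ≤ W.card := by
    have h1 : p * (U.card * (n - 1 - D0)) ≤ p * (W.card * U.card) + K * n * (q * U.card) :=
      (Nat.mul_le_mul_left p e1).trans (e2.trans (by omega))
    have h2 : (p * U.card) * (4 * (n - 1 - D0)) ≤ (p * U.card) * (4 * W.card + n) := by
      have : 4 * (K * n * (q * U.card)) = p * U.card * n := by subst hp; ring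
      calc _ = 4 * (p * (U.card * (n - 1 - D0))) := by ring
        _ ≤ 4 * (p * (W.card * U.card) + K * n * (q * U.card)) := Nat.mul_le_mul_left _ h1
        _ = 4 * (p * (W.card * U.card)) + 4 * (K * n * (q * U.card)) := by ring
        _ = _ := by rw [this]; ring
    have := Nat.le_of_mul_le_mul_left h2 (by positivity)
    omega
  obtain ⟨M, hMW, hMm⟩ := Finset.exists_subset_card_eq hWm
  set d := (n + p - 1) / p with hd
  have hpd : n ≤ p * d := by
    have := Nat.div_add_mod (n + p - 1) p
    have := Nat.mod_lt (n + p - 1) hp0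
    rw [← hd] at *
    omega
  have hdle : ∀ z, n ≤ p * z → d ≤ z := by
    intro z hz
    rw [hd, Nat.div_le_iff_le_mul_add_pred hp0]
    omega
  have hd0 : 0 < d := by
    rcases Nat.eq_zero_or_pos d with h | h
    · rw [h] at hpd; omega
    · exact h
  have hdM : ∀ x ∈ M, d ≤ (nb G U x).card := by
    intro x hx
    exact hdle _ (Finset.mem_filter.1 (hMW hx)).2
  have hm0 : 0 < m := by subst hm; have : 0 < J := by omega
                         positivity
  obtain ⟨X, hXM, hXJ, CX, hCX, hCX2, hXd⟩ := cover' (G := G) U M d J hd0 (Finset.card_pos.1 (by omega)) hdM (by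
    rw [hMm, hm]
    calc 2 * J * U.card ≤ 2 * J * (K * n) := Nat.mul_le_mul_left _ hUn
      _ ≤ 2 * J * (K * (p * d)) := by gcongr
      _ = _ := by ring)
  rw [hMm] at hXd
  obtain ⟨Y, hYs, hYJ⟩ := Finset.exists_subset_card_eq (n := J)
    (s := CX) (by
      have : p * (2 ^ (m + 1) * J) ≤ p * d := hn2.trans hpd
      have := Nat.le_of_mul_le_mul_left this hp0
      exact Nat.le_of_mul_le_mul_left (this.trans hXd) (by positivity))
  obtain ⟨S, hSX, hSs⟩ := Finset.exists_subset_card_eq (hJ.trans hXJ)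
  obtain ⟨T, hTS, hT2, A, hAU, hA2, hTd⟩ := cover' (G := G) U S d 2 hd0 (Finset.card_pos.1 (by omega))
    (fun x hx => hdM x (hXM (hSX hx))) (by
    rw [hSs, hs]
    calc 2 * 2 * U.card ≤ 2 * 2 * (K * n) := Nat.mul_le_mul_left _ hUn
      _ ≤ 2 * 2 * (K * (p * d)) := by gcongr
      _ = _ := by ring)
  rw [hSs] at hTd
  obtain ⟨x1, h1, x2, h2, h12⟩ := Finset.one_lt_card.1 (by omega : 1 < T.card)
  refine ⟨X, Y, A, x1, x2, ?_, hYs.trans hCX, hAU,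
    hXJ, hMm ▸ Finset.card_le_card hXM, hYJ, ?_, hSX (hTS h1), hSX (hTS h2), h12, ?_, ?_⟩
  · rw [Finset.disjoint_left]
    intro x hx
    exact (hRm x).1 (Finset.mem_filter.1 (hMW (hXM hx))).1
  · intro x hx y hy
    exact hCX2 y (hYs hy) x hx
  · intro y hy
    have := hA2 y hy
    exact ⟨this _ h1, this _ h2⟩
  · rw [mul_assoc]
    exact hpd.trans (Nat.mul_le_mul_left _ hTd)

theorem hub_step {V : Type} [Fintype V] {G : SimpleGraph V} (K q J D0 n b i : ℕ) (hK : 1 ≤ K) (hq : 1 ≤ q)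
    (p s m : ℕ) (hp : p = 4 * K * q) (hs : s = 4 * K * p) (hm : m = 2 * J * K * p) (hJ : s ≤ J)
    (hb : b ≤ J)
    (hcard : Fintype.card V ≤ K * n) (hdeg : ∀ v, n - 1 ≤ (nb G Finset.univ v).card)
    (D : Finset V) (c : V → ℕ) (hD : D.card ≤ D0) (hU : n ≤ q * (unc D c).card)
    (hn1 : 4 * m + 4 + 4 * D0 ≤ n) (hn2 : p * (2 ^ (m + 1) * J) ≤ n)
    (hc : ∀ v, c v ≤ i) (hL : Lk G D c 2 b) :
    ∃ (D' : Finset V) (c' : V → ℕ), D'.card ≤ D.card + (m + J) ∧ (∀ v, c' v ≤ i + 1) ∧ Lk G D' c' 2 b ∧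
      p * 2 ^ (s + 1) * (unc D' c').card + n ≤ p * 2 ^ (s + 1) * (unc D c).card := by
  obtain ⟨X, Y, A, x1, x2, hXD, hYU, hAU, hXJ, hXm, hYJ, hXY, h1, h2, h12, hA, hAn⟩ :=
    hub_find (G := G) K q J D0 n hK hq p s m hp hs hm hJ hcard hdeg D (unc D c) hD hU hn1 hn2
  have hYD : ∀ y ∈ Y, y ∉ D := fun y hy => (mem_unc.1 (hYU hy)).1
  have hAD : ∀ y ∈ A, y ∉ D := fun y hy => (mem_unc.1 (hAU hy)).1
  have hXD' : ∀ y ∈ X, y ∉ D := fun y hy => Finset.disjoint_left.1 hXD hy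
  refine ⟨D ∪ (X ∪ Y), fun v => if v ∈ X ∪ Y ∨ v ∈ A then i + 1 else c v, ?_, ?_, ?_, ?_⟩
  · have h3 := Finset.card_union_le D (X ∪ Y)
    have h4 := Finset.card_union_le X Y
    omega
  · intro v
    have := hc v
    dsimp only
    split_ifs <;> omega
  · intro u v hu hv huv hcuv hcu j hj1 hj2
    rw [Finset.mem_union, not_or] at hu hv
    have hcu' := hc u
    have hcv' := hc v
    simp only [hu.2, hv.2, false_or] at hcuv hcu ⊢
    by_cases huA : u ∈ A
    · have hvA : v ∈ A := by
        by_contra hvA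
        simp only [huA, hvA, if_true, if_false] at hcuv
        omega
      obtain ⟨l, hl, hn, hm, hch, hla⟩ := hub_path (G := G) (j - 2) X Y x1 x2 hXY h1 h2 h12 (by omega) (by omega)
      refine ⟨x1 :: l, by omega, hn, ?_, ?_⟩
      · intro x hx
        have hx' := hm x hx
        refine ⟨Finset.mem_union_right _ hx', ?_⟩
        simp only [hx', huA, true_or, if_true]
      · rw [List.cons_append, List.isChain_cons_cons]
        refine ⟨(hA u huA).1.symm, ?_⟩
        rw [← List.cons_append, List.isChain_append]
        refine ⟨hch, by simp, ?_⟩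
        intro x hx y hy
        rw [hla] at hx
        simp at hx hy
        subst hx; subst hy
        exact (hA _ hvA).2
    · have hvA : v ∉ A := by
        intro hvA
        simp only [huA, hvA, if_true, if_false] at hcuv
        omega
      simp only [huA, hvA, if_false] at hcuv hcu ⊢
      obtain ⟨l, hl, hn, hm, hch⟩ := hL u v hu.1 hv.1 huv hcuv hcu j hj1 hj2
      refine ⟨l, hl, hn, ?_, hch⟩
      intro x hx
      have h3 := hm x hx
      refine ⟨Finset.mem_union_left _ h3.1, ?_⟩
      rw [if_neg, h3.2]
      rintro (h | h)
      · rw [Finset.mem_union] at h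
        rcases h with h | h
        · exact hXD' x h h3.1
        · exact hYD x h h3.1
      · exact hAD x h h3.1
  · have h3 : unc (D ∪ (X ∪ Y)) (fun v => if v ∈ X ∪ Y ∨ v ∈ A then i + 1 else c v) ⊆ unc D c \ A := by
      intro v hv
      rw [mem_unc, Finset.mem_union, not_or] at hv
      rw [Finset.mem_sdiff, mem_unc]
      have hvA : v ∉ A := by
        intro h
        have := hv.2
        simp [h] at this
      have := hv.2
      rw [if_neg (by tauto)] at this
      exact ⟨⟨hv.1.1, this⟩, hvA⟩
    have h4 := Finset.card_le_card h3
    rw [Finset.card_sdiff_of_subset hAU] at h4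
    have h5 := Finset.card_le_card hAU
    calc _ ≤ p * 2 ^ (s + 1) * ((unc D c).card - A.card) + p * 2 ^ (s + 1) * A.card := by gcongr
      _ = p * 2 ^ (s + 1) * ((unc D c).card - A.card + A.card) := by ring
      _ = _ := by rw [Nat.sub_add_cancel h5]

theorem phase1 (K q : ℕ) (hK : 1 ≤ K) (hq : 1 ≤ q) : ∃ h : ℕ, ∀ b : ℕ, ∃ D0 n1 : ℕ, ∀ n, n1 ≤ n →
    ∀ (V : Type) [Fintype V] (G : SimpleGraph V), Fintype.card V ≤ K * n →
    (∀ v, n - 1 ≤ (nb G Finset.univ v).card) →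
    ∃ (D : Finset V) (c : V → ℕ), D.card ≤ D0 ∧ (∀ v, c v ≤ h) ∧ Lk G D c 2 b ∧ q * (unc D c).card < n := by
  obtain ⟨p, hp⟩ : ∃ p, p = 4 * K * q := ⟨_, rfl⟩
  obtain ⟨s, hs⟩ : ∃ s, s = 4 * K * p := ⟨_, rfl⟩
  obtain ⟨E, hE⟩ : ∃ E, E = p * 2 ^ (s + 1) := ⟨_, rfl⟩
  refine ⟨E * K + 1, fun b => ?_⟩
  obtain ⟨J, hJ⟩ : ∃ J, J = b + s := ⟨_, rfl⟩
  obtain ⟨m, hm⟩ : ∃ m, m = 2 * J * K * p := ⟨_, rfl⟩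
  refine ⟨(E * K + 1) * (m + J), 4 * m + 4 + 4 * ((E * K + 1) * (m + J)) + p * (2 ^ (m + 1) * J), ?_⟩
  intro n hn V _ G hcard hdeg
  have key : ∀ r, r ≤ E * K + 1 → ∃ (D : Finset V) (c : V → ℕ), D.card ≤ r * (m + J) ∧ (∀ v, c v ≤ r) ∧
      Lk G D c 2 b ∧ (q * (unc D c).card < n ∨ E * (unc D c).card + r * n ≤ E * (K * n)) := by
    intro r
    induction r with
    | zero =>
      intro _
      refine ⟨∅, fun _ => 0, by simp, by simp, ?_, Or.inr ?_⟩
      · intro u v _ _ _ _ h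
        exact absurd rfl h
      · have : (unc ∅ (fun _ : V => 0)).card ≤ K * n := (Finset.card_le_univ _).trans hcard
        simpa using Nat.mul_le_mul_left E this
    | succ r ih =>
      intro hr
      obtain ⟨D, c, hD, hc, hL, hU⟩ := ih (by omega)
      have hrr : r * (m + J) ≤ (E * K + 1) * (m + J) := Nat.mul_le_mul_right _ (by omega)
      by_cases hq' : q * (unc D c).card < n
      · exact ⟨D, c, hD.trans (Nat.mul_le_mul_right _ (by omega)), fun v => (hc v).trans (by omega), hL, Or.inl hq'⟩
      · have hU' := hU.resolve_left hq'
        obtain ⟨D', c', h1, h2, h3, h4⟩ := hub_step K q J ((E * K + 1) * (m + J)) n b r hK hq p s m hp hs hm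
          (by omega) (by omega) hcard hdeg D c (hD.trans hrr) (by omega) (by omega) (by omega) hc hL
        refine ⟨D', c', ?_, h2, h3, Or.inr ?_⟩
        · rw [Nat.succ_mul]; omega
        · rw [← hE] at h4
          rw [Nat.succ_mul]; omega
  obtain ⟨D, c, hD, hc, hL, hU⟩ := key (E * K + 1) le_rfl
  refine ⟨D, c, hD, hc, hL, hU.resolve_right ?_⟩
  intro h
  have : (E * K + 1) * n = E * (K * n) + n := by ring
  omega

theorem cross_link {V : Type} {G : SimpleGraph V} {D : Finset V} {c : V → ℕ} {a b : ℕ}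
    (hL : Lk G D c a b) {u0 u1 w u v : V} (hu0 : u0 ∉ D) (hu1 : u1 ∉ D) (hw : w ∉ D) (hu : u ∉ D)
    (hv : v ∉ D) (h0 : G.Adj w u0) (h1 : G.Adj w u1) (hc0 : c u0 ≠ 0) (hc1 : c u1 ≠ 0)
    (hc01 : c u0 ≠ c u1) (hcu : c u = c u0) (hcv : c v = c u1) (huu : u ≠ u0) (hvv : v ≠ u1)
    (j : ℕ) (hj : 2 * a + 1 ≤ j) (hjb : j ≤ b) :
    ∃ l : List V, l.length + 1 = 2 * j ∧ l.Nodup ∧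
      (∀ x ∈ l, x = w ∨ x = u0 ∨ x = u1 ∨ (x ∈ D ∧ (c x = c u0 ∨ c x = c u1))) ∧
      (u :: (l ++ [v])).IsChain G.Adj := by
  obtain ⟨l1, hl1, hn1, hm1, hch1⟩ := hL u u0 hu hu0 huu hcu (by rw [hcu]; exact hc0) a le_rfl (by omega)
  obtain ⟨l2, hl2, hn2, hm2, hch2⟩ := hL u1 v hu1 hv hvv.symm hcv.symm hc1 (j - a - 1) (by omega) (by omega)
  have hne : u0 ≠ u1 := fun h => hc01 (by rw [h])
  refine ⟨l1 ++ u0 :: w :: u1 :: l2, ?_, ?_, ?_, ?_⟩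
  · simp only [List.length_append, List.length_cons]; omega
  · rw [List.nodup_append]
    refine ⟨hn1, ?_, ?_⟩
    · have a1 : u0 ∉ l2 := fun h => hu0 (hm2 _ h).1
      have a2 : u1 ∉ l2 := fun h => hu1 (hm2 _ h).1
      have a3 : w ∉ l2 := fun h => hw (hm2 _ h).1
      simp [a1, a2, a3, hn2, hne, h0.ne.symm, h1.ne]
    · intro x hx y hy hxy
      subst hxy
      have hx1 := hm1 x hx
      simp only [List.mem_cons] at hy
      rcases hy with rfl | rfl | rfl | hy
      · exact hu0 hx1.1
      · exact hw hx1.1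
      · exact hu1 hx1.1
      · have := hm2 x hy
        exact hc01 (by rw [← hcu, ← hx1.2, this.2])
  · intro x hx
    simp only [List.mem_append, List.mem_cons] at hx
    rcases hx with hx | rfl | rfl | rfl | hx
    · have := hm1 x hx
      rw [hcu] at this
      tauto
    · tauto
    · tauto
    · tauto
    · have := hm2 x hx
      tauto
  · have e : u :: ((l1 ++ u0 :: w :: u1 :: l2) ++ [v]) = (u :: l1) ++ u0 :: (w :: u1 :: (l2 ++ [v])) := by simp
    rw [e, List.isChain_split]
    refine ⟨hch1, ?_⟩
    rw [List.isChain_cons_cons, List.isChain_cons_cons]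
    exact ⟨h0.symm, h1, hch2⟩

theorem Lk_mono {V : Type} {G : SimpleGraph V} {D : Finset V} {c : V → ℕ} {a a' b : ℕ}
    (hL : Lk G D c a b) (h : a ≤ a') : Lk G D c a' b :=
  fun u v h1 h2 h3 h4 h5 j h6 h7 => hL u v h1 h2 h3 h4 h5 j (h.trans h6) h7

theorem merge_step {V : Type} {G : SimpleGraph V} {D : Finset V} {c : V → ℕ} {a b : ℕ}
    (hL : Lk G D c a b) {u0 u1 w : V} (hu0 : u0 ∉ D) (hu1 : u1 ∉ D) (hw : w ∉ D)
    (h0 : G.Adj w u0) (h1 : G.Adj w u1) (hc0 : c u0 ≠ 0) (hc1 : c u1 ≠ 0)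
    (hc01 : c u0 ≠ c u1) :
    Lk G (D ∪ {u0, w, u1}) (fun x => if x = w ∨ c x = c u1 then c u0 else c x) (2 * a + 1) b := by
  intro u v hu hv huv hcuv hcu j hj1 hj2
  simp only [Finset.mem_union, Finset.mem_insert, Finset.mem_singleton, not_or] at hu hv
  obtain ⟨hu, huu0, huw, huu1⟩ := hu
  obtain ⟨hv, hvu0, hvw, hvu1⟩ := hv
  simp only [huw, hvw, false_or] at hcuv hcu ⊢
  have hcr : ∀ x, (x = w ∨ x = u0 ∨ x = u1 ∨ (x ∈ D ∧ (c x = c u0 ∨ c x = c u1))) →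
      x ∈ D ∪ {u0, w, u1} ∧ (if x = w ∨ c x = c u1 then c u0 else c x) = c u0 := by
    intro x hx
    constructor
    · simp only [Finset.mem_union, Finset.mem_insert, Finset.mem_singleton]; tauto
    · split_ifs with h
      · rfl
      · rcases hx with rfl | rfl | rfl | ⟨_, hx | hx⟩
        · tauto
        · rfl
        · tauto
        · exact hx
        · tauto
  by_cases he : c u = c v
  · have hcu0 : c u ≠ 0 := by
      split_ifs at hcu with h
      · rw [h]; exact hc1
      · exact hcu
    obtain ⟨l, hl, hn, hm, hch⟩ := hL u v hu hv huv he hcu0 j (by omega) hj2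
    refine ⟨l, hl, hn, ?_, hch⟩
    intro x hx
    obtain ⟨h3, h4⟩ := hm x hx
    have hxw : x ≠ w := fun h => hw (h ▸ h3)
    refine ⟨Finset.mem_union_left _ h3, ?_⟩
    simp only [hxw, false_or, h4]
  · by_cases h3 : c u = c u1
    · have h4 : c v ≠ c u1 := fun h => he (by rw [h3, h])
      simp only [h3, h4, if_true, if_false] at hcuv hcu ⊢
      obtain ⟨l, hl, hn, hm, hch⟩ := cross_link hL hu1 hu0 hw hu hv h1 h0 hc1 hc0 hc01.symm h3 hcuv.symm huu1 hvu0 j hj1 hj2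
      exact ⟨l, hl, hn, fun x hx => hcr x (by have := hm x hx; tauto), hch⟩
    · have h4 : c v = c u1 := by
        by_contra h4
        simp only [h3, h4, if_false] at hcuv
        exact he hcuv
      simp only [h3, h4, if_true, if_false] at hcuv hcu ⊢
      obtain ⟨l, hl, hn, hm, hch⟩ := cross_link hL hu0 hu1 hw hu hv h0 h1 hc0 hc1 hc01 hcuv h4 huu0 hvu1 j hj1 hj2
      exact ⟨l, hl, hn, fun x hx => by rw [hcuv]; exact hcr x (hm x hx), hch⟩

theorem phase2 {V : Type} [Fintype V] {G : SimpleGraph V} (b : ℕ) : ∀ (m : ℕ) (D : Finset V) (c : V → ℕ) (a : ℕ)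
    (S : Finset ℕ), S.card ≤ m → (∀ v, c v ≠ 0 → c v ∈ S) → Lk G D c a b →
    ∃ (D' : Finset V) (c' : V → ℕ), D'.card ≤ D.card + 3 * m ∧ Lk G D' c' (2 ^ m * (a + 1)) b ∧
      unc D' c' ⊆ unc D c ∧ ∀ u u' w, u ∉ D' → u' ∉ D' → w ∉ D' → G.Adj w u → G.Adj w u' → c' u ≠ 0 →
        c' u' ≠ 0 → c' u = c' u' := by
  intro m
  induction m with
  | zero =>
    intro D c a S hS hc hL
    refine ⟨D, c, by omega, Lk_mono hL (by simp), subset_rfl, ?_⟩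
    intro u u' w _ _ _ _ _ hu _
    have := hc u hu
    have := Finset.card_pos.2 ⟨_, this⟩
    omega
  | succ m ih =>
    intro D c a S hS hc hL
    by_cases hcon : ∀ u u' w, u ∉ D → u' ∉ D → w ∉ D → G.Adj w u → G.Adj w u' → c u ≠ 0 →
        c u' ≠ 0 → c u = c u'
    · refine ⟨D, c, by omega, Lk_mono hL ?_, subset_rfl, hcon⟩
      have : 1 ≤ 2 ^ (m + 1) := Nat.one_le_two_pow
      nlinarith
    · push Not at hcon
      obtain ⟨u0, u1, w, hu0, hu1, hw, h0, h1, hc0, hc1, hc01⟩ := hcon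
      obtain ⟨D', c', h2, h3, h4, h5⟩ := ih (D ∪ {u0, w, u1}) (fun x => if x = w ∨ c x = c u1 then c u0 else c x)
        (2 * a + 1) (S.erase (c u1)) (by rw [Finset.card_erase_of_mem (hc u1 hc1)]; omega) (by
          intro v hv
          split_ifs at hv ⊢ with h
          · exact Finset.mem_erase.2 ⟨hc01, hc u0 hc0⟩
          · exact Finset.mem_erase.2 ⟨fun h' => h (Or.inr h'), hc v hv⟩)
        (merge_step hL hu0 hu1 hw h0 h1 hc0 hc1 hc01)
      refine ⟨D', c', ?_, ?_, ?_, h5⟩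
      · have := Finset.card_union_le D {u0, w, u1}
        have := Finset.card_le_three (a := u0) (b := w) (c := u1)
        omega
      · have : 2 ^ (m + 1) * (a + 1) = 2 ^ m * (2 * a + 1 + 1) := by ring
        rw [this]; exact h3
      · refine h4.trans ?_
        intro v hv
        rw [mem_unc] at hv ⊢
        simp only [Finset.mem_union, Finset.mem_insert, Finset.mem_singleton, not_or] at hv
        refine ⟨hv.1.1, ?_⟩
        have h6 := hv.2
        split_ifs at h6 with h
        · exact absurd h6 hc0
        · exact h6

theorem big_path_cycle {V : Type} {G : SimpleGraph V} {D : Finset V} {c : V → ℕ} {A n : ℕ} (hA : 1 ≤ A)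
    (hn : 2 * A + 4 ≤ n) (hev : Even n) (hL : Lk G D c A A)
    (hcon : ∀ u u' w, u ∉ D → u' ∉ D → w ∉ D → G.Adj w u → G.Adj w u' → c u ≠ 0 →
        c u' ≠ 0 → c u = c u') (f : ℕ → V) (hf : IsPth G f (n - 2 * A + 1))
    (hfD : ∀ i < n - 2 * A + 1, f i ∉ D ∧ c (f i) ≠ 0) : HasCycleLen G n := by
  obtain ⟨r, hr⟩ := hev
  have hcol : ∀ i, 2 * i < n - 2 * A + 1 → c (f (2 * i)) = c (f 0) := by
    intro i
    induction i with
    | zero => intro _; rfl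
    | succ i ih =>
      intro hi
      rw [← ih (by omega)]
      have e : 2 * (i + 1) = 2 * i + 1 + 1 := by ring
      rw [e]
      refine hcon _ _ (f (2 * i + 1)) (hfD _ (by omega)).1 (hfD _ (by omega)).1 (hfD _ (by omega)).1
        (hf.2 _ (by omega)) (hf.2 _ (by omega)).symm (hfD _ (by omega)).2 (hfD _ (by omega)).2
  have hlast : c (f (n - 2 * A)) = c (f 0) := by
    have e : n - 2 * A = 2 * (r - A) := by omega
    rw [e]; exact hcol _ (by omega)
  obtain ⟨l, hl, hln, hm, hch⟩ := hL (f (n - 2 * A)) (f 0) (hfD _ (by omega)).1 (hfD _ (by omega)).1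
    (fun h => by have := hf.1 _ _ (by omega) (by omega) h; omega) hlast (hfD _ (by omega)).2 A le_rfl le_rfl
  obtain ⟨p1, p2⟩ := pth_list hf
  have hlen : ((List.range (n - 2 * A + 1)).map f ++ l).length = n := by
    simp; omega
  rw [← hlen]
  have hlne : l ≠ [] := by rintro rfl; simp at hl; omega
  rw [← List.cons_append, List.isChain_append] at hch
  have hrlast : ((List.range (n - 2 * A + 1)).map f).getLast? = some (f (n - 2 * A)) := by
    rw [List.range_succ, List.map_append]; simp
  have hrhead : ((List.range (n - 2 * A + 1)).map f).head? = some (f 0) := by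
    rw [List.range_succ_eq_map]; simp
  apply cyc_of_list
  · rw [List.nodup_append]
    refine ⟨p1, hln, ?_⟩
    intro x hx y hy hxy
    subst hxy
    obtain ⟨i, hi, rfl⟩ := List.mem_map.1 hx
    exact (hfD i (by simpa using hi)).1 (hm _ hy).1
  · rw [List.isChain_append]
    refine ⟨p2, hch.1.tail, ?_⟩
    intro x hx y hy
    rw [hrlast] at hx
    simp at hx
    subst hx
    have h3 := hch.1
    cases l with
    | nil => simp at hy
    | cons z l =>
      simp at hy
      subst hy
      exact (List.isChain_cons_cons.1 h3).1
  · rw [hlen]; omega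
  · intro x hx y hy
    rw [List.head?_append_of_ne_nil _ (by simp), hrhead] at hy
    rw [List.getLast?_append_of_ne_nil _ hlne] at hx
    refine hch.2.2 x ?_ y (by simpa using hy)
    cases l with
    | nil => simp at hlne
    | cons z l => rw [List.getLast?_cons_cons]; exact hx

theorem main_deg (K : ℕ) (hK : 1 ≤ K) : ∃ n0 : ℕ, ∀ n, n0 ≤ n → Even n → ∀ (V : Type) [Fintype V] (G : SimpleGraph V),
    Fintype.card V = K * (n - 1) + 1 → (∀ v, n - 1 ≤ (nb G Finset.univ v).card) → HasCycleLen G n := by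
  obtain ⟨h, hh⟩ := phase1 K (2 * (K + 2)) hK (by omega)
  obtain ⟨A, hA⟩ : ∃ A, A = 2 ^ h * 3 := ⟨_, rfl⟩
  obtain ⟨D0, n1, hn1⟩ := hh A
  have hA1 : 1 ≤ A := by rw [hA]; have := Nat.one_le_two_pow (n := h); omega
  refine ⟨n1 + 2 * A + 4 + 2 * ((K + 2) * (D0 + 3 * h + 1) + 1), ?_⟩
  intro n hn hev V _ G hcard hdeg
  obtain ⟨D, c, hD, hc, hL, hU⟩ := hn1 n (by omega) V G (by
    rw [hcard]
    obtain ⟨r, rfl⟩ : ∃ r, n = r + 1 := ⟨n - 1, by omega⟩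
    simp only [Nat.add_sub_cancel, mul_add]; omega) hdeg
  obtain ⟨D', c', h2, h3, h4, h5⟩ := phase2 (G := G) A h D c 2 (Finset.Icc 1 h) (by simp) (by
    intro v hv
    rw [Finset.mem_Icc]
    exact ⟨by omega, hc v⟩) hL
  have hA' : 2 ^ h * (2 + 1) = A := by rw [hA]
  rw [hA'] at h3
  by_cases hex : ∃ f, IsPth G f (n - 2 * A + 1) ∧ ∀ i < n - 2 * A + 1, f i ∉ D' ∪ unc D' c'
  · obtain ⟨f, hf, hfD⟩ := hex
    apply big_path_cycle hA1 (by omega) hev h3 h5 f hf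
    intro i hi
    have := hfD i hi
    rw [Finset.mem_union, mem_unc] at this
    tauto
  · have hB : (D' ∪ unc D' c').card ≤ D0 + 3 * h + (unc D c).card := by
      have e1 := Finset.card_union_le D' (unc D' c')
      have e2 := Finset.card_le_card h4
      omega
    obtain ⟨g, hg⟩ := finish K n (n - 2 * A + 1) hK hcard hdeg (D' ∪ unc D' c') (by
      have e3 : (K + 2) * ((D' ∪ unc D' c').card + 1) ≤ (K + 2) * (D0 + 3 * h + (unc D c).card + 1) :=
        Nat.mul_le_mul_left _ (by omega)
      have e4 : (K + 2) * (D0 + 3 * h + (unc D c).card + 1) =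
        (K + 2) * (D0 + 3 * h + 1) + (K + 2) * (unc D c).card := by ring
      have e5 : 2 * (K + 2) * (unc D c).card = 2 * ((K + 2) * (unc D c).card) := by ring
      omega) (by omega) (by omega) hex
    exact cyc_has hg (by omega)

theorem upper (k : ℕ) : ∃ n0 : ℕ, ∀ n, n0 ≤ n → Even n → ∀ (V : Type) [Fintype V] (G : SimpleGraph V),
    Fintype.card V = (k + 1) * (n - 1) + 1 → HasCycleLen G n ∨ HasBook Gᶜ k n := by
  induction k with
  | zero =>
    refine ⟨1, fun n hn _ V _ G hcard => Or.inr ?_⟩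
    obtain ⟨T, -, hT⟩ := Finset.exists_subset_card_eq (s := (Finset.univ : Finset V)) (n := n)
      (by rw [Finset.card_univ, hcard]; omega)
    exact ⟨∅, T, by simp, hT, by simp, by simp, by simp⟩
  | succ k ih =>
    obtain ⟨n1, h1⟩ := ih
    obtain ⟨n2, h2⟩ := main_deg (k + 1 + 1) (by omega)
    refine ⟨n1 + n2 + 2, fun n hn hev V _ G hcard => ?_⟩
    by_cases hdeg : ∀ v, n - 1 ≤ (nb G Finset.univ v).card
    · exact Or.inl (h2 n (by omega) hev V G hcard hdeg)
    · push Not at hdeg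
      obtain ⟨u, hu⟩ := hdeg
      have hNu : (insert u (nb G Finset.univ u)).card ≤ n - 1 := by
        have := Finset.card_insert_le u (nb G Finset.univ u)
        omega
      have e1 : (k + 1 + 1) * (n - 1) = (k + 1) * (n - 1) + (n - 1) := by ring
      obtain ⟨R, hR1, -, hR⟩ := Finset.exists_subsuperset_card_eq
        (Finset.subset_univ (insert u (nb G Finset.univ u))) hNu (by
          rw [Finset.card_univ, hcard]; omega)
      have huR : u ∈ R := hR1 (Finset.mem_insert_self _ _)
      have hcard' : Fintype.card {x // x ∉ R} = (k + 1) * (n - 1) + 1 := by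
        have := Fintype.card_subtype_compl (fun x => x ∈ R)
        rw [this, Fintype.card_coe, hcard, hR]
        omega
      have hG' : ∀ a b : {x // x ∉ R}, (G.comap (Subtype.val : {x // x ∉ R} → V)).Adj a b ↔ G.Adj a.1 b.1 :=
        fun a b => Iff.rfl
      rcases h1 n (by omega) hev {x // x ∉ R} (G.comap Subtype.val) hcard' with ⟨v, w, hw, hl⟩ | ⟨S, T, hS, hT, hST, hSS, hSTa⟩
      · left
        let φ : G.comap (Subtype.val : {x // x ∉ R} → V) →g G := ⟨Subtype.val, fun h => h⟩
        refine ⟨_, w.map φ, ?_, ?_⟩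
        · exact (SimpleGraph.Walk.isCycle_map_iff_of_injective (f := φ) Subtype.val_injective).2 hw
        · rw [SimpleGraph.Walk.length_map, hl]
      · right
        have huadj : ∀ x : {x // x ∉ R}, Gᶜ.Adj u x.1 := by
          intro x
          rw [SimpleGraph.compl_adj]
          refine ⟨fun h => x.2 (h ▸ huR), fun h => x.2 (hR1 ?_)⟩
          exact Finset.mem_insert_of_mem (mem_nb.2 ⟨Finset.mem_univ _, h⟩)
        have hcomp : ∀ x y : {x // x ∉ R}, (G.comap Subtype.val)ᶜ.Adj x y → Gᶜ.Adj x.1 y.1 := by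
          intro x y h
          rw [SimpleGraph.compl_adj] at h ⊢
          exact ⟨fun h' => h.1 (Subtype.ext h'), h.2⟩
        have huS : ∀ A : Finset {x // x ∉ R}, u ∉ A.map (Function.Embedding.subtype _) := by
          intro A h
          obtain ⟨x, -, hx⟩ := Finset.mem_map.1 h
          exact x.2 (by rw [show x.1 = u from hx]; exact huR)
        refine ⟨insert u (S.map (Function.Embedding.subtype _)), T.map (Function.Embedding.subtype _), ?_, ?_, ?_, ?_, ?_⟩
        · rw [Finset.card_insert_of_notMem (huS S), Finset.card_map, hS]
        · rw [Finset.card_map, hT]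
        · rw [Finset.disjoint_insert_left]
          exact ⟨huS T, (Finset.disjoint_map _).2 hST⟩
        · intro a ha b hb hab
          rw [Finset.mem_insert, Finset.mem_map] at ha hb
          rcases ha with rfl | ⟨a, ha, rfl⟩ <;> rcases hb with rfl | ⟨b, hb, rfl⟩
          · exact absurd rfl hab
          · exact huadj b
          · exact (huadj a).symm
          · exact hcomp a b (hSS a ha b hb (fun h => hab (by rw [h])))
        · intro a ha b hb
          rw [Finset.mem_insert, Finset.mem_map] at ha
          obtain ⟨b, hbT, rfl⟩ := Finset.mem_map.1 hb
          rcases ha with rfl | ⟨a, ha, rfl⟩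
          · exact huadj b
          · exact hcomp a b (hSTa a ha b hbT)

theorem lower (k n N : ℕ) (hn : 2 ≤ n) (hN : N ≤ (k + 1) * (n - 1)) : ¬ RamseyProp n k n N := by
  intro hR
  let G : SimpleGraph (Fin N) :=
    { Adj := fun v w => v ≠ w ∧ v.val / (n - 1) = w.val / (n - 1)
      symm := ⟨fun u v h => ⟨h.1.symm, h.2.symm⟩⟩
      loopless := ⟨fun u h => h.1 rfl⟩ }
  have hcl : ∀ (r : ℕ) (T : Finset (Fin N)), (∀ t ∈ T, t.val / (n - 1) = r) → T.card ≤ n - 1 := by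
    intro r T hT
    have : T.card ≤ (Finset.range (n - 1)).card := by
      apply Finset.card_le_card_of_injOn (fun t => t.val % (n - 1))
      · intro t _
        simpa using Nat.mod_lt _ (by omega : 0 < n - 1)
      · intro a ha b hb hab
        apply Fin.ext
        have h1 := Nat.div_add_mod a.val (n - 1)
        have h2 := Nat.div_add_mod b.val (n - 1)
        rw [hT a ha] at h1
        rw [hT b hb] at h2
        dsimp only at hab
        omega
    simpa using this
  rcases hR G with ⟨v, c, hc, hl⟩ | ⟨S, T, hS, hT, hST, hSS, hSTa⟩
  · have hw : ∀ u v (w : G.Walk u v), ∀ x ∈ w.support, x.val / (n - 1) = u.val / (n - 1) := by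
      intro u v w
      induction w with
      | nil => intro x hx; simp at hx; rw [hx]
      | cons h w ih =>
        intro x hx
        rw [SimpleGraph.Walk.support_cons, List.mem_cons] at hx
        rcases hx with rfl | hx
        · rfl
        · rw [ih x hx]; exact h.2.symm
    have h1 := hcl (v.val / (n - 1)) c.support.tail.toFinset (by
      intro t ht
      exact hw _ _ c t (List.mem_of_mem_tail (List.mem_toFinset.1 ht)))
    rw [List.toFinset_card_of_nodup hc.support_nodup, List.length_tail, SimpleGraph.Walk.length_support] at h1
    omega
  · have hg : ∀ a b, Gᶜ.Adj a b → a.val / (n - 1) ≠ b.val / (n - 1) := by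
      intro a b h h'
      rw [SimpleGraph.compl_adj] at h
      exact h.2 ⟨h.1, h'⟩
    have hr : ∀ a : Fin N, a.val / (n - 1) < k + 1 := by
      intro a
      rw [Nat.div_lt_iff_lt_mul (by omega)]
      have := a.2
      omega
    set I := S.image (fun a => a.val / (n - 1)) with hI
    have hIc : I.card = k := by
      rw [hI, Finset.card_image_of_injOn, hS]
      intro a ha b hb hab
      by_contra hne
      exact hg a b (hSS a ha b hb hne) hab
    have hIs : I ⊆ Finset.range (k + 1) := by
      intro x hx
      obtain ⟨a, -, rfl⟩ := Finset.mem_image.1 hx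
      exact Finset.mem_range.2 (hr a)
    have h1 : (Finset.range (k + 1) \ I).card = 1 := by
      rw [Finset.card_sdiff_of_subset hIs, hIc, Finset.card_range]; omega
    obtain ⟨r, hr1⟩ := Finset.card_eq_one.1 h1
    have := hcl r T (by
      intro t ht
      have : t.val / (n - 1) ∈ Finset.range (k + 1) \ I := by
        rw [Finset.mem_sdiff]
        refine ⟨Finset.mem_range.2 (hr t), fun h => ?_⟩
        obtain ⟨a, ha, hat⟩ := Finset.mem_image.1 h
        exact hg a t (hSTa a ha t ht) hat
      rw [hr1] at this
      simpa using this)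
    omega

end Aux

theorem stmt3 (k : ℕ) (hk : 1 ≤ k) :
    ∃ n₀ : ℕ, 0 < n₀ ∧ ∀ n : ℕ, n₀ ≤ n → Even n →
      IsLeast {N | RamseyProp n k n N} ((k + 1) * (n - 1) + 1) := by
  obtain ⟨n0, h0⟩ := upper k
  refine ⟨n0 + 2, by omega, fun n hn hev => ⟨?_, ?_⟩⟩
  · intro G
    exact h0 n (by omega) hev _ G (Fintype.card_fin _)
  · intro N hN
    by_contra hlt
    exact lower k n N (by omega) (by omega) hN
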